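/- Let (X_1, X_2) be an osculating pair of length-t walks (sharing no edge, every shared interior vertex an osculation) with set E of shared interior vertices. For each subset S ⊆ E, let (X^S_1, X^S_2) be the pair of walks obtained from (X_1,X_2) by replacing the osculation at each vertex of S with a crossing (i.e. at each v=(s,h) ∈ S the outgoing local steps of the two walks at time s are interchanged, so that at v one walk has two +1 steps and the other two −1 steps, while at vertices of E∖S the osculation is kept); the pairs (X^S_1,X^S_2) for S ⊆ E are pairwise distinct, and Σ_{S ⊆ E} (−1)^{|S|} · W(X^S_1)·W(X^S_2) = Π_{z ∈ E} ( w5(z)·w6(z) − w3(z)·w4(z) ) · Π_E, where Π_E is W(X_1)·W(X_2) with the factor w5(z)·w6(z) removed for every z ∈ E. -/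

import Mathlib

namespace OscSixVertex

open Finset

attribute [local instance] Classical.propDecidable

variable {R : Type*} [CommRing R]

/-- The integer value of a step: `true` is an up (+1) step, `false` a down (−1) step. -/
def stepVal (b : Bool) : ℤ := if b then 1 else -1

/-- The step taken by the walk with step sequence `σ` between times `s` and `s+1`. -/
def stepAt {t : ℕ} (σ : Fin t → Bool) (s : ℕ) : ℤ :=
  if h : s < t then stepVal (σ ⟨s, h⟩) else 0

/-- The height at time `s` of the length-`t` walk starting at `a` with step sequence `σ`. -/
def height {t : ℕ} (a : ℤ) (σ : Fin t → Bool) (s : ℕ) : ℤ :=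
  a + ∑ j ∈ Finset.range s, stepAt σ j

/-- The local vertex weight at vertex `v`, given incoming step `din` and outgoing step `dout`:
`w3` for (+1,+1), `w4` for (−1,−1), `w5` for a peak (+1,−1), `w6` for a valley (−1,+1). -/
def localW (w3 w4 w5 w6 : ℕ × ℤ → R) (v : ℕ × ℤ) (din dout : ℤ) : R :=
  if din = 1 then (if dout = 1 then w3 v else w5 v)
  else (if dout = 1 then w6 v else w4 v)

/-- The vertex weight `W(X)` of a single walk: product over interior times `1 ≤ s ≤ t−1`. -/
def walkW (w3 w4 w5 w6 : ℕ × ℤ → R) {t : ℕ} (a : ℤ) (σ : Fin t → Bool) : R :=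
  ∏ s ∈ Finset.Ico 1 t,
    localW w3 w4 w5 w6 (s, height a σ s) (stepAt σ (s - 1)) (stepAt σ s)

/-- The single-walk generating function `F_t(a → b)`. -/
def genF (w3 w4 w5 w6 : ℕ × ℤ → R) (t : ℕ) (a b : ℤ) : R :=
  ∑ σ ∈ Finset.univ.filter (fun σ : Fin t → Bool => height a σ t = b),
    walkW w3 w4 w5 w6 a σ

/-- Two walks share an edge. -/
def SharesEdge {t : ℕ} (a₁ : ℤ) (σ₁ : Fin t → Bool) (a₂ : ℤ) (σ₂ : Fin t → Bool) : Prop :=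
  ∃ s, s < t ∧ height a₁ σ₁ s = height a₂ σ₂ s ∧ height a₁ σ₁ (s + 1) = height a₂ σ₂ (s + 1)

/-- The walk has a peak at time `s`: step in +1, step out −1. -/
def PeakAt {t : ℕ} (σ : Fin t → Bool) (s : ℕ) : Prop :=
  stepAt σ (s - 1) = 1 ∧ stepAt σ s = -1

/-- The walk has a valley at time `s`: step in −1, step out +1. -/
def ValleyAt {t : ℕ} (σ : Fin t → Bool) (s : ℕ) : Prop :=
  stepAt σ (s - 1) = -1 ∧ stepAt σ s = 1

/-- A pair of walks is osculating: no shared edge, and at every shared interior vertex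
one walk has a peak and the other a valley. -/
def OscPair {t : ℕ} (a₁ : ℤ) (σ₁ : Fin t → Bool) (a₂ : ℤ) (σ₂ : Fin t → Bool) : Prop :=
  ¬ SharesEdge a₁ σ₁ a₂ σ₂ ∧
  ∀ s, 1 ≤ s → s < t → height a₁ σ₁ s = height a₂ σ₂ s →
    ((PeakAt σ₁ s ∧ ValleyAt σ₂ s) ∨ (ValleyAt σ₁ s ∧ PeakAt σ₂ s))

/-- An `N`-walk is osculating if each pair of its walks is osculating. -/
def OscNWalk {N t : ℕ} (a : Fin N → ℤ) (σ : Fin N → Fin t → Bool) : Prop :=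
  ∀ α β, α ≠ β → OscPair (a α) (σ α) (a β) (σ β)

/-- The vertex weight `𝒲(X)` of an osculating `N`-walk: product over all interior vertices
visited; a vertex shared by two walks contributes `w2`, any other vertex contributes the
single-walk weight of the unique walk through it. -/
def oscW (w2 w3 w4 w5 w6 : ℕ × ℤ → R) {N t : ℕ}
    (a : Fin N → ℤ) (σ : Fin N → Fin t → Bool) : R :=
  ∏ s ∈ Finset.Ico 1 t,
    ∏ h ∈ Finset.image (fun α => height (a α) (σ α) s) Finset.univ,
      if ∃ α β : Fin N, α ≠ β ∧ height (a α) (σ α) s = h ∧ height (a β) (σ β) s = h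
      then w2 (s, h)
      else ∏ α ∈ Finset.univ.filter (fun α : Fin N => height (a α) (σ α) s = h),
        localW w3 w4 w5 w6 (s, h) (stepAt (σ α) (s - 1)) (stepAt (σ α) s)

/-- Interchange the tails of the two step sequences at every time in `S`:
the result follows `σ₁` while the number of switch times passed so far is even,
and `σ₂` when it is odd. -/
def swapSteps {t : ℕ} (σ₁ σ₂ : Fin t → Bool) (S : Finset ℕ) : Fin t → Bool :=
  fun j => if Even ((S.filter (fun s => s ≤ (j : ℕ))).card) then σ₁ j else σ₂ j


theorem even_card_filter_lt_succ (S : Finset ℕ) (s : ℕ) :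
    Even (S.filter (fun u => u < s + 1)).card ↔
      (Even (S.filter (fun u => u < s)).card ↔ s ∉ S) := by
  have h : S.filter (fun u => u < s + 1)
      = S.filter (fun u => u < s) ∪ S.filter (fun u => u = s) := by
    ext u; simp only [mem_filter, mem_union]; grind
  have hd : Disjoint (S.filter (fun u => u < s)) (S.filter (fun u => u = s)) := by
    rw [Finset.disjoint_left]; intro u; simp only [mem_filter]; grind
  rw [h, card_union_of_disjoint hd, Finset.filter_eq' S s, Nat.even_add]
  split_ifs with hs <;> simp [hs]

theorem swapSteps_apply {t : ℕ} (σ₁ σ₂ : Fin t → Bool) (S : Finset ℕ) (j : Fin t) :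
    swapSteps σ₁ σ₂ S j
      = if Even (S.filter (fun u => u < (j : ℕ) + 1)).card then σ₁ j else σ₂ j := by
  simp only [swapSteps, Nat.lt_succ_iff]

theorem stepAt_swapSteps {t : ℕ} (σ₁ σ₂ : Fin t → Bool) (S : Finset ℕ) (s : ℕ) :
    stepAt (swapSteps σ₁ σ₂ S) s
      = if Even (S.filter (fun u => u < s + 1)).card then stepAt σ₁ s else stepAt σ₂ s := by
  unfold stepAt
  by_cases h : s < t
  · simp only [dif_pos h, swapSteps_apply]
    split_ifs <;> rfl
  · simp [h]

theorem height_succ {t : ℕ} (a : ℤ) (σ : Fin t → Bool) (s : ℕ) :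
    height a σ (s + 1) = height a σ s + stepAt σ s := by
  simp only [height, Finset.sum_range_succ, add_assoc]

theorem height_swapSteps {t : ℕ} {a₁ a₂ : ℤ} {σ₁ σ₂ : Fin t → Bool} {S : Finset ℕ}
    (hS : ∀ s ∈ S, height a₁ σ₁ s = height a₂ σ₂ s) (s : ℕ) :
    height a₁ (swapSteps σ₁ σ₂ S) s
      = if Even (S.filter (fun u => u < s)).card then height a₁ σ₁ s else height a₂ σ₂ s := by
  induction s with
  | zero => simp [height]
  | succ s ih =>
    have hp := even_card_filter_lt_succ S s
    have hs := hS s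
    rw [height_succ, height_succ, height_succ, ih, stepAt_swapSteps]
    split_ifs <;> simp_all

/-- Switching an osculation at time `s` to a crossing replaces the local factor `w5 * w6` by
`w3 * w4`; all other local factors are unchanged. -/
theorem localW_mul_localW_swapSteps {R : Type*} [CommRing R] {t : ℕ} (w3 w4 w5 w6 : ℕ × ℤ → R)
    {a₁ a₂ : ℤ} {σ₁ σ₂ : Fin t → Bool} {S : Finset ℕ}
    (hS : ∀ s ∈ S, height a₁ σ₁ s = height a₂ σ₂ s ∧
      ((PeakAt σ₁ s ∧ ValleyAt σ₂ s) ∨ (ValleyAt σ₁ s ∧ PeakAt σ₂ s)))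
    {s : ℕ} (hs : 1 ≤ s) :
    localW w3 w4 w5 w6 (s, height a₁ (swapSteps σ₁ σ₂ S) s)
        (stepAt (swapSteps σ₁ σ₂ S) (s - 1)) (stepAt (swapSteps σ₁ σ₂ S) s)
      * localW w3 w4 w5 w6 (s, height a₂ (swapSteps σ₂ σ₁ S) s)
        (stepAt (swapSteps σ₂ σ₁ S) (s - 1)) (stepAt (swapSteps σ₂ σ₁ S) s)
      = if s ∈ S then w3 (s, height a₁ σ₁ s) * w4 (s, height a₁ σ₁ s)
        else localW w3 w4 w5 w6 (s, height a₁ σ₁ s) (stepAt σ₁ (s - 1)) (stepAt σ₁ s)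
          * localW w3 w4 w5 w6 (s, height a₂ σ₂ s) (stepAt σ₂ (s - 1)) (stepAt σ₂ s) := by
  have hp := even_card_filter_lt_succ S s
  rw [height_swapSteps fun u hu => (hS u hu).1, height_swapSteps fun u hu => (hS u hu).1.symm]
  simp only [stepAt_swapSteps, Nat.sub_add_cancel hs]
  by_cases hmem : s ∈ S
  · obtain ⟨he, ⟨⟨h1, h2⟩, h3, h4⟩ | ⟨⟨h1, h2⟩, h3, h4⟩⟩ := hS s hmem <;>
      by_cases hev : Even (S.filter (fun u => u < s)).card <;>
      simp_all [localW, mul_comm]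
  · by_cases hev : Even (S.filter (fun u => u < s)).card <;>
      simp_all [mul_comm, -Nat.not_even_iff_odd]

theorem localW_mul_localW_of_osculation {R : Type*} [CommRing R] {t : ℕ}
    (w3 w4 w5 w6 : ℕ × ℤ → R) {σ₁ σ₂ : Fin t → Bool} {s : ℕ}
    (h : (PeakAt σ₁ s ∧ ValleyAt σ₂ s) ∨ (ValleyAt σ₁ s ∧ PeakAt σ₂ s)) (v : ℕ × ℤ) :
    localW w3 w4 w5 w6 v (stepAt σ₁ (s - 1)) (stepAt σ₁ s)
      * localW w3 w4 w5 w6 v (stepAt σ₂ (s - 1)) (stepAt σ₂ s) = w5 v * w6 v := by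
  obtain ⟨⟨h1, h2⟩, h3, h4⟩ | ⟨⟨h1, h2⟩, h3, h4⟩ := h <;> simp [localW, h1, h2, h3, h4, mul_comm]

/-- Where the two walks take different steps, the swapped walk determines the parity of the
number of switches made so far. -/
theorem even_iff_even_of_swapSteps_eq {t : ℕ} {σ₁ σ₂ : Fin t → Bool} {S₁ S₂ : Finset ℕ}
    (h : swapSteps σ₁ σ₂ S₁ = swapSteps σ₁ σ₂ S₂) {s : ℕ} (hs : stepAt σ₁ s ≠ stepAt σ₂ s) :
    Even (S₁.filter (fun u => u < s + 1)).card ↔ Even (S₂.filter (fun u => u < s + 1)).card := by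
  have h1 := congrArg (fun σ => stepAt σ s) h
  simp only [stepAt_swapSteps] at h1
  split_ifs at h1 <;> simp_all [-Nat.not_even_iff_odd]

theorem mem_iff_mem_of_swapSteps_eq {t : ℕ} {σ₁ σ₂ : Fin t → Bool} {S₁ S₂ : Finset ℕ}
    (h : swapSteps σ₁ σ₂ S₁ = swapSteps σ₁ σ₂ S₂) {s : ℕ} (hs : 1 ≤ s)
    (hosc : (PeakAt σ₁ s ∧ ValleyAt σ₂ s) ∨ (ValleyAt σ₁ s ∧ PeakAt σ₂ s)) :
    s ∈ S₁ ↔ s ∈ S₂ := by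
  have hne : stepAt σ₁ (s - 1) ≠ stepAt σ₂ (s - 1) ∧ stepAt σ₁ s ≠ stepAt σ₂ s := by
    obtain ⟨⟨h1, h2⟩, h3, h4⟩ | ⟨⟨h1, h2⟩, h3, h4⟩ := hosc <;> simp [h1, h2, h3, h4]
  have h1 := even_iff_even_of_swapSteps_eq h hne.1
  have h2 := even_iff_even_of_swapSteps_eq h hne.2
  rw [Nat.sub_add_cancel hs] at h1
  rw [even_card_filter_lt_succ, even_card_filter_lt_succ] at h2
  tauto

/-- **Resolving the osculations of an osculating pair.**
Let `(X₁, X₂)` be an osculating pair with set `E` of shared interior vertices (recorded by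
their times).  For `S ⊆ E` let `(X^S₁, X^S₂)` be obtained by turning the osculation at each
time of `S` into a crossing (interchanging the outgoing steps, i.e. swapping the tails,
there).  These pairs are pairwise distinct, and the signed sum of their products of
single-walk weights is `∏_{z ∈ E} (w5 z · w6 z − w3 z · w4 z)` times the product of the
weights of `(X₁, X₂)` at all the interior vertices outside `E`. -/
theorem osculation_resolution_sum {R : Type*} [CommRing R]
    (t : ℕ) (w3 w4 w5 w6 : ℕ × ℤ → R)
    (a₁ a₂ : ℤ) (σ₁ σ₂ : Fin t → Bool)
    (hinit : a₁ ≠ a₂) (hfin : height a₁ σ₁ t ≠ height a₂ σ₂ t)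
    (hosc : OscPair a₁ σ₁ a₂ σ₂)
    (E : Finset ℕ)
    (hE : E = (Finset.Ico 1 t).filter (fun s => height a₁ σ₁ s = height a₂ σ₂ s)) :
    (∀ S₁ ∈ E.powerset, ∀ S₂ ∈ E.powerset,
        (swapSteps σ₁ σ₂ S₁, swapSteps σ₂ σ₁ S₁)
          = (swapSteps σ₁ σ₂ S₂, swapSteps σ₂ σ₁ S₂) → S₁ = S₂) ∧
    ∑ S ∈ E.powerset, (-1 : R) ^ S.card *
        (walkW w3 w4 w5 w6 a₁ (swapSteps σ₁ σ₂ S)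
          * walkW w3 w4 w5 w6 a₂ (swapSteps σ₂ σ₁ S))
      = (∏ z ∈ E, (w5 (z, height a₁ σ₁ z) * w6 (z, height a₁ σ₁ z)
            - w3 (z, height a₁ σ₁ z) * w4 (z, height a₁ σ₁ z)))
        * ((∏ u ∈ Finset.Ico 1 t \ E,
              localW w3 w4 w5 w6 (u, height a₁ σ₁ u) (stepAt σ₁ (u - 1)) (stepAt σ₁ u))
          * (∏ u ∈ Finset.Ico 1 t \ E,
              localW w3 w4 w5 w6 (u, height a₂ σ₂ u) (stepAt σ₂ (u - 1)) (stepAt σ₂ u))) := by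
  have hosc' : ∀ s ∈ E, 1 ≤ s ∧ height a₁ σ₁ s = height a₂ σ₂ s ∧
      ((PeakAt σ₁ s ∧ ValleyAt σ₂ s) ∨ (ValleyAt σ₁ s ∧ PeakAt σ₂ s)) := by
    intro s hs
    rw [hE, mem_filter, mem_Ico] at hs
    exact ⟨hs.1.1, hs.2, hosc.2 s hs.1.1 hs.1.2 hs.2⟩
  have hsub : E ⊆ Finset.Ico 1 t := hE ▸ filter_subset _ _
  refine ⟨fun S₁ h₁ S₂ h₂ heq => ?_, ?_⟩
  · rw [mem_powerset] at h₁ h₂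
    have hmem : ∀ s ∈ E, (s ∈ S₁ ↔ s ∈ S₂) := fun s hs =>
      mem_iff_mem_of_swapSteps_eq (Prod.ext_iff.mp heq).1 (hosc' s hs).1 (hosc' s hs).2.2
    ext s
    exact ⟨fun h => (hmem s (h₁ h)).mp h, fun h => (hmem s (h₂ h)).mpr h⟩
  · rw [← prod_mul_distrib]
    simp only [sub_eq_neg_add]
    rw [prod_add, sum_mul]
    refine sum_congr rfl fun S hS => ?_
    rw [mem_powerset] at hS
    rw [prod_neg, walkW, walkW, ← prod_mul_distrib,
      prod_congr rfl fun s hs => localW_mul_localW_swapSteps w3 w4 w5 w6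
        (fun u hu => (hosc' u (hS hu)).2) (mem_Ico.mp hs).1,
      ← prod_sdiff hsub, ← prod_sdiff hS,
      prod_congr (s₁ := S) rfl fun s hs => if_pos hs,
      prod_congr (s₁ := E \ S) rfl fun s hs => (if_neg (mem_sdiff.mp hs).2).trans
        (by
          have h := hosc' s (mem_sdiff.mp hs).1
          rw [← h.2.1, localW_mul_localW_of_osculation w3 w4 w5 w6 h.2.2]),
      prod_congr (s₁ := Finset.Ico 1 t \ E) rfl fun s hs =>
        if_neg fun h => (mem_sdiff.mp hs).2 (hS h)]
    ring

end OscSixVertex
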